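/- Let T and T' be non-isomorphic trees on n vertices whose adjacency matrices have the same characteristic polynomial, and suppose this common characteristic polynomial is irreducible over ℚ and Δ(T) = 2^n·d² for some odd square-free positive integer d. Then no signed graph whose underlying graph is T is generalized cospectral with a signed graph whose underlying graph is T': if A and B are adjacency matrices of signed graphs with underlying graphs T and T' respectively, then det(xI−A) ≠ det(xI−B) or det(xI−(J−I−A)) ≠ det(xI−(J−I−B)). -/

import Mathlib

open Matrix Polynomial
open scoped Classical

/-- An enumeration of the complex roots (with multiplicity) of a polynomial that has
exactly `n` roots, obtained by choice (and junk otherwise). -/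
noncomputable def rootsEnum (n : ℕ) (f : Polynomial ℂ) : Fin n → ℂ :=
  if h : ∃ α : Fin n → ℂ, f.roots = Multiset.map α Finset.univ.val then h.choose
  else fun _ => 0

/-- The discriminant `∏_{i<j} (αᵢ - αⱼ)²` of a polynomial with `n` complex roots
`α₁, …, αₙ` listed with multiplicity. -/
noncomputable def polyDisc (n : ℕ) (f : Polynomial ℂ) : ℂ :=
  ∏ i : Fin n, ∏ j ∈ Finset.univ.filter (fun j => i < j),
    (rootsEnum n f i - rootsEnum n f j) ^ 2

/-- The adjacency matrix of a signed graph: a symmetric integer matrix with zero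
diagonal and all entries in `{-1, 0, 1}`. -/
def IsSignedAdjMatrix {n : ℕ} (A : Matrix (Fin n) (Fin n) ℤ) : Prop :=
  A.IsSymm ∧ (∀ i, A i i = 0) ∧ ∀ i j, A i j = -1 ∨ A i j = 0 ∨ A i j = 1


section Moments

variable {ι R : Type*} [Fintype ι] [DecidableEq ι] [CommRing R]

theorem Matrix.charpoly_neg_eq_comp (M : Matrix ι ι R) :
    (-M).charpoly = (-1) ^ Fintype.card ι * M.charpoly.comp (-X) := by
  have h : (-M).charmatrix = -(M.charmatrix.map fun p => p.comp (-X)) := by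
    ext i j : 1
    by_cases hij : i = j
    · subst hij; simp; ring
    · simp [hij]
  rw [charpoly, h, det_neg, charpoly, ← Polynomial.coe_compRingHom_apply, RingHom.map_det]
  rfl

/-- The matrix generating function `∑ Aᵏ tᵏ`. -/
noncomputable def Matrix.powSeries (A : Matrix ι ι R) : Matrix ι ι (PowerSeries R) :=
  of fun i j => PowerSeries.mk fun k => (A ^ k) i j

theorem Matrix.one_sub_X_smul_mul_powSeries (A : Matrix ι ι R) :
    (1 - (PowerSeries.X : PowerSeries R) • A.map (PowerSeries.C (R := R))) * A.powSeries = 1 := by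
  rw [sub_mul, one_mul, smul_mul_assoc, sub_eq_iff_eq_add]
  ext i j k
  rcases k with _ | k
  · by_cases hij : i = j <;> simp [powSeries, hij]
  · by_cases hij : i = j <;>
      simp [powSeries, hij, mul_apply, PowerSeries.coeff_succ_X_mul, pow_succ',
        PowerSeries.coeff_one]

theorem Matrix.coe_charpolyRev (A : Matrix ι ι R) :
    ((A.charpolyRev : R[X]) : PowerSeries R)
      = det (1 - (PowerSeries.X : PowerSeries R) • A.map (PowerSeries.C (R := R))) := by
  rw [charpolyRev, ← Polynomial.coeToPowerSeries.ringHom_apply, RingHom.map_det]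
  congr 1
  ext1 i j
  by_cases hij : i = j <;> simp [hij] <;> ring

theorem Matrix.coe_charpolyRev_sub_ones (A : Matrix ι ι R) :
    (((A - of fun _ _ => (1 : R)).charpolyRev : R[X]) : PowerSeries R)
      = ((A.charpolyRev : R[X]) : PowerSeries R) * (1 + PowerSeries.X *
          PowerSeries.mk fun k => (1 : ι → R) ⬝ᵥ (A ^ k *ᵥ 1)) := by
  have hu : IsUnit
      (1 - (PowerSeries.X : PowerSeries R) • A.map (PowerSeries.C (R := R))).det :=
    isUnit_det_of_right_inverse A.one_sub_X_smul_mul_powSeries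
  have hinv := inv_eq_right_inv A.one_sub_X_smul_mul_powSeries
  have h := det_add_replicateCol_mul_replicateRow (ι := Unit) hu
    (fun _ => PowerSeries.X) (fun _ => 1)
  rw [hinv, det_unique (_ + _ * _ * _)] at h
  rw [coe_charpolyRev, coe_charpolyRev]
  convert h using 2
  · ext1 i j
    by_cases hij : i = j <;> simp [hij, mul_apply] <;> ring
  · ext k
    rcases k with _ | k
    · simp [mul_apply, ← Finset.sum_mul]
    · simp [mul_apply, mul_comm _ PowerSeries.X, PowerSeries.coeff_succ_X_mul, powSeries, mulVec,
        dotProduct, PowerSeries.coeff_one]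
      exact Finset.sum_comm

/-- Generalized cospectral matrices have the same walk counts. -/
theorem Matrix.walkCount_eq_of_charpoly_eq [IsDomain R] {A B : Matrix ι ι R}
    (h : A.charpoly = B.charpoly)
    (h' : ((of fun _ _ => (1 : R)) - 1 - A).charpoly = ((of fun _ _ => (1 : R)) - 1 - B).charpoly)
    (k : ℕ) : (1 : ι → R) ⬝ᵥ (A ^ k *ᵥ 1) = 1 ⬝ᵥ (B ^ k *ᵥ 1) := by
  have key (C : Matrix ι ι R) : (C - of fun _ _ => (1 : R)).charpoly =
      (-1) ^ Fintype.card ι *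
        (((of fun _ _ => (1 : R)) - 1 - C).charpoly.comp (X + Polynomial.C (-1))).comp (-X) := by
    rw [← charpoly_sub_scalar, ← charpoly_neg_eq_comp]
    congr 1
    ext i j
    by_cases hij : i = j <;> simp [hij]
    ring
  have h2 : (A - of fun _ _ => (1 : R)).charpolyRev = (B - of fun _ _ => (1 : R)).charpolyRev := by
    rw [← reverse_charpoly, ← reverse_charpoly, key, key, h']
  have h1 : A.charpolyRev = B.charpolyRev := by
    rw [← reverse_charpoly, ← reverse_charpoly, h]
  have h3 := congrArg (fun p : R[X] => (p : PowerSeries R)) h2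
  simp only [coe_charpolyRev_sub_ones, h1] at h3
  have hB : (B.charpolyRev : PowerSeries R) ≠ 0 := by
    intro h0
    have := eval_charpolyRev (M := B)
    rw [Polynomial.coe_eq_zero_iff] at h0
    simp [h0] at this
  have h4 := add_left_cancel (mul_left_cancel₀ hB h3)
  have h5 := congrArg (PowerSeries.coeff (k + 1)) h4
  simpa [PowerSeries.coeff_succ_X_mul] using h5

end Moments

section Cyclic

variable {n : ℕ} {A B : Matrix (Fin n) (Fin n) ℚ}

/-- The walk matrix, with columns `v, A v, …, Aⁿ⁻¹ v`. -/
def Matrix.walkMatrix (A : Matrix (Fin n) (Fin n) ℚ) (v : Fin n → ℚ) : Matrix (Fin n) (Fin n) ℚ :=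
  of fun i j => (A ^ (j : ℕ) *ᵥ v) i

theorem Matrix.walkMatrix_mulVec (A : Matrix (Fin n) (Fin n) ℚ) (v c : Fin n → ℚ) :
    A.walkMatrix v *ᵥ c = aeval A (∑ j : Fin n, Polynomial.C (c j) * X ^ (j : ℕ)) *ᵥ v := by
  simp only [map_sum, map_mul, aeval_C, map_pow, aeval_X, sum_mulVec]
  ext i
  simp only [mulVec, dotProduct, walkMatrix, of_apply, Finset.sum_apply,
    Algebra.algebraMap_eq_smul_one, smul_mul_assoc, one_mul, smul_apply, smul_eq_mul,
    Finset.sum_mul]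
  exact Finset.sum_congr rfl fun _ _ => Finset.sum_congr rfl fun _ _ => by ring

theorem Matrix.aeval_mulVec_eq_zero_iff (hA : Irreducible A.charpoly) {v : Fin n → ℚ} (hv : v ≠ 0)
    {p : ℚ[X]} : aeval A p *ᵥ v = 0 ↔ A.charpoly ∣ p := by
  constructor
  · intro h
    by_contra hp
    obtain ⟨a, b, hab⟩ := (hA.coprime_iff_not_dvd (n := p)).2 hp
    apply hv
    have := congrArg (fun q => aeval A q *ᵥ v) hab
    simpa [aeval_self_charpoly, add_mulVec, ← mulVec_mulVec, h] using this.symm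
  · rintro ⟨q, rfl⟩
    simp [aeval_self_charpoly]

theorem Matrix.isUnit_walkMatrix (hA : Irreducible A.charpoly) {v : Fin n → ℚ} (hv : v ≠ 0) :
    IsUnit (A.walkMatrix v).det := by
  rw [isUnit_iff_ne_zero]
  intro h
  obtain ⟨c, hc, h0⟩ := exists_mulVec_eq_zero_iff.2 h
  rw [walkMatrix_mulVec, aeval_mulVec_eq_zero_iff hA hv] at h0
  apply hc
  have hz : ∑ j : Fin n, Polynomial.C (c j) * X ^ (j : ℕ) = 0 := by
    apply eq_zero_of_dvd_of_degree_lt h0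
    rw [charpoly_degree_eq_dim, Fintype.card_fin]
    exact degree_sum_fin_lt c
  ext i
  have := congrArg (coeff · (i : ℕ)) hz
  simpa [finsetSum_coeff, coeff_X_pow, Fin.val_inj] using this

theorem Matrix.exists_aeval_mulVec_eq (hA : Irreducible A.charpoly) {v : Fin n → ℚ} (hv : v ≠ 0)
    (w : Fin n → ℚ) : ∃ p : ℚ[X], aeval A p *ᵥ v = w :=
  ⟨_, by rw [← walkMatrix_mulVec A v ((A.walkMatrix v)⁻¹ *ᵥ w), mulVec_mulVec,
    mul_nonsing_inv _ (isUnit_walkMatrix hA hv), one_mulVec]⟩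

theorem Polynomial.commute_aeval {S R : Type*} [CommSemiring S] [Semiring R] [Algebra S R]
    {a b : R} (h : Commute a b) (p : S[X]) : Commute a (aeval b p) := by
  induction p using Polynomial.induction_on' with
  | add p q hp hq => rw [map_add]; exact hp.add_right hq
  | monomial k c =>
    rw [aeval_monomial]
    exact (Algebra.commute_algebraMap_right c a).mul_right (h.pow_right k)

theorem Matrix.IsSymm.aeval {ι R : Type*} [Fintype ι] [DecidableEq ι] [CommRing R]
    {M : Matrix ι ι R} (h : M.IsSymm) (p : R[X]) : (Polynomial.aeval M p).IsSymm := by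
  induction p using Polynomial.induction_on' with
  | add p q hp hq => rw [map_add]; exact hp.add hq
  | monomial k c =>
    rw [aeval_monomial, ← Algebra.smul_def]
    exact (h.pow k).smul c

theorem Matrix.exists_eq_aeval_of_commute (hA : Irreducible A.charpoly)
    {Z : Matrix (Fin n) (Fin n) ℚ} (hZ : Commute Z A) : ∃ p : ℚ[X], Z = aeval A p := by
  rcases n.eq_zero_or_pos with rfl | hn
  · exact ⟨0, Subsingleton.elim _ _⟩
  have : Nonempty (Fin n) := ⟨⟨0, hn⟩⟩
  have hv : (1 : Fin n → ℚ) ≠ 0 := one_ne_zero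
  obtain ⟨p, hp⟩ := exists_aeval_mulVec_eq hA hv (Z *ᵥ 1)
  refine ⟨p, ext_of_mulVec_single fun i => ?_⟩
  obtain ⟨q, hq⟩ := exists_aeval_mulVec_eq hA hv (Pi.single i 1)
  have hc : Z * aeval A q = aeval A q * Z := (commute_aeval hZ q).eq
  rw [← hq, mulVec_mulVec, mulVec_mulVec, hc, ← mulVec_mulVec, ← hp, mulVec_mulVec, ← map_mul,
    ← map_mul, mul_comm]

/-- A symmetric-commutant orthogonal matrix is `±1`. -/
theorem Matrix.eq_one_or_neg_one_of_commute (hA : Irreducible A.charpoly) (hs : A.IsSymm)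
    {Z : Matrix (Fin n) (Fin n) ℚ} (hZ : Commute Z A) (hZZ : Z * Zᵀ = 1) : Z = 1 ∨ Z = -1 := by
  rcases n.eq_zero_or_pos with rfl | hn
  · exact .inl (Subsingleton.elim _ _)
  have : Nonempty (Fin n) := ⟨⟨0, hn⟩⟩
  have hv : (1 : Fin n → ℚ) ≠ 0 := one_ne_zero
  obtain ⟨p, rfl⟩ := exists_eq_aeval_of_commute hA hZ
  rw [(hs.aeval p).eq] at hZZ
  have hd : A.charpoly ∣ (p - 1) * (p + 1) := by
    rw [← aeval_mulVec_eq_zero_iff hA hv]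
    have : aeval A ((p - 1) * (p + 1)) = 0 := by
      rw [show (p - 1) * (p + 1) = p * p - 1 by ring]
      simp [hZZ]
    rw [this, zero_mulVec]
  have h0 {q : ℚ[X]} (h : A.charpoly ∣ q) : aeval A q = 0 := by
    obtain ⟨r, rfl⟩ := h
    simp [aeval_self_charpoly]
  rcases hA.prime.dvd_or_dvd hd with h | h
  · left; simpa [sub_eq_zero] using h0 h
  · right; simpa [add_eq_zero_iff_eq_neg] using h0 h

theorem Matrix.exists_orthogonal_of_walkCount_eq (hA : Irreducible A.charpoly)
    (hB : Irreducible B.charpoly) (hAs : A.IsSymm) (hBs : B.IsSymm)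
    (h : ∀ k : ℕ, (1 : Fin n → ℚ) ⬝ᵥ (A ^ k *ᵥ 1) = 1 ⬝ᵥ (B ^ k *ᵥ 1)) :
    ∃ Q : Matrix (Fin n) (Fin n) ℚ, Qᵀ * Q = 1 ∧ Q * Qᵀ = 1 ∧ Q *ᵥ 1 = 1 ∧ A * Q = Q * B := by
  rcases n.eq_zero_or_pos with rfl | hn
  · exact ⟨1, Subsingleton.elim _ _, Subsingleton.elim _ _, Subsingleton.elim _ _,
      Subsingleton.elim _ _⟩
  have : Nonempty (Fin n) := ⟨⟨0, hn⟩⟩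
  have hv : (1 : Fin n → ℚ) ≠ 0 := one_ne_zero
  have hUA := isUnit_walkMatrix hA hv
  have hUB := isUnit_walkMatrix hB hv
  have gram (C : Matrix (Fin n) (Fin n) ℚ) (hC : C.IsSymm) (k : ℕ) (i j : Fin n) :
      ((C.walkMatrix 1)ᵀ * (C ^ k * C.walkMatrix 1)) i j = 1 ⬝ᵥ (C ^ (i + k + j : ℕ) *ᵥ 1) := by
    change (C ^ (i : ℕ) *ᵥ 1) ⬝ᵥ (C ^ k *ᵥ (C ^ (j : ℕ) *ᵥ 1)) = _
    rw [pow_add, pow_add, ← mulVec_mulVec, ← mulVec_mulVec, dotProduct_mulVec 1 (C ^ (i : ℕ)),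
      ← mulVec_transpose, (hC.pow i).eq]
  have hg (k : ℕ) : (A.walkMatrix 1)ᵀ * (A ^ k * A.walkMatrix 1)
      = (B.walkMatrix 1)ᵀ * (B ^ k * B.walkMatrix 1) := by
    ext i j
    rw [gram A hAs, gram B hBs, h]
  set U := A.walkMatrix 1
  set V := B.walkMatrix 1
  have hVV : V * V⁻¹ = 1 := mul_nonsing_inv _ hUB
  have hVVt : V⁻¹ᵀ * Vᵀ = 1 := by rw [← transpose_mul, hVV, transpose_one]
  have hQ : (U * V⁻¹)ᵀ * (U * V⁻¹) = 1 := by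
    have := hg 0
    simp only [pow_zero, one_mul] at this
    calc (U * V⁻¹)ᵀ * (U * V⁻¹) = V⁻¹ᵀ * (Uᵀ * U) * V⁻¹ := by
          simp only [transpose_mul, Matrix.mul_assoc]
      _ = (V⁻¹ᵀ * Vᵀ) * (V * V⁻¹) := by rw [this]; simp only [Matrix.mul_assoc]
      _ = 1 := by rw [hVV, hVVt, one_mul]
  have hQ' := mul_eq_one_comm.1 hQ
  refine ⟨U * V⁻¹, hQ, hQ', ?_, ?_⟩
  · have hcol (C : Matrix (Fin n) (Fin n) ℚ) :
        C.walkMatrix 1 *ᵥ Pi.single ⟨0, hn⟩ 1 = 1 := by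
      ext i
      simp [walkMatrix]
    rw [← hcol B, ← mulVec_mulVec, mulVec_mulVec _ V⁻¹, nonsing_inv_mul _ hUB, one_mulVec, hcol,
      hcol]
  · have h1 : (U * V⁻¹)ᵀ * A * (U * V⁻¹) = B := by
      have := hg 1
      simp only [pow_one] at this
      calc (U * V⁻¹)ᵀ * A * (U * V⁻¹) = V⁻¹ᵀ * (Uᵀ * (A * U)) * V⁻¹ := by
            simp only [transpose_mul, Matrix.mul_assoc]
        _ = (V⁻¹ᵀ * Vᵀ) * B * (V * V⁻¹) := by rw [this]; simp only [Matrix.mul_assoc]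
        _ = B := by rw [hVV, hVVt, one_mul, mul_one]
    calc A * (U * V⁻¹) = (U * V⁻¹ * (U * V⁻¹)ᵀ) * A * (U * V⁻¹) := by rw [hQ', one_mul]
      _ = U * V⁻¹ * ((U * V⁻¹)ᵀ * A * (U * V⁻¹)) := by simp only [Matrix.mul_assoc]
      _ = U * V⁻¹ * B := by rw [h1]

end Cyclic

section NumberField

open Module NumberField nonZeroDivisors

variable {F : Type*} [Field F]

theorem exists_int_matrix_of_mem_span {ι κ : Type*} [Fintype κ] {v : ι → F} {w : κ → F}
    (h : ∀ i, v i ∈ Submodule.span ℤ (Set.range w)) :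
    ∃ P : Matrix ι κ ℤ, v = P.map (Int.cast : ℤ → F) *ᵥ w := by
  choose c hc using fun i => (Submodule.mem_span_range_iff_exists_fun ℤ).1 (h i)
  exact ⟨of c, funext fun i => by simp [mulVec, dotProduct, ← hc i]⟩

theorem mul_mem_span_of_mem_adjoin {R : Type*} [CommRing R] [Algebra R F] {β : F} {κ : Type*}
    {w : κ → F} (hβ : ∀ i, β * w i ∈ Submodule.span R (Set.range w)) {y : F}
    (hy : y ∈ Algebra.adjoin R {β}) {x : F} (hx : x ∈ Submodule.span R (Set.range w)) :
    y * x ∈ Submodule.span R (Set.range w) := by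
  induction hy using Algebra.adjoin_induction generalizing x with
  | mem y hy =>
    rw [Set.mem_singleton_iff.1 hy]
    induction hx using Submodule.span_induction with
    | mem x hx => obtain ⟨i, rfl⟩ := hx; exact hβ i
    | zero => simp
    | add a b _ _ ha hb => rw [mul_add]; exact add_mem ha hb
    | smul r a _ ha => rw [mul_smul_comm]; exact Submodule.smul_mem _ _ ha
  | algebraMap r => rw [← Algebra.smul_def]; exact Submodule.smul_mem _ _ hx
  | add a b _ _ ha hb => rw [add_mul]; exact add_mem (ha hx) (hb hx)
  | mul a b _ _ ha hb => rw [mul_assoc]; exact ha (hb hx)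

theorem mul_mem_span_of_mulVec_eq (R : Type*) [CommRing R] [Algebra R F] {β : F} {κ : Type*}
    [Fintype κ] {Y : Matrix κ κ ℤ} {w : κ → F} (h : Y.map (Int.cast : ℤ → F) *ᵥ w = β • w) (i : κ) :
    β * w i ∈ Submodule.span R (Set.range w) := by
  have h1 : ∑ j, (Y i j : F) * w j = β * w i := congrFun h i
  rw [← h1]
  refine sum_mem fun j _ => ?_
  rw [← zsmul_eq_mul]
  have hj : w j ∈ Submodule.span R (Set.range w) := Submodule.subset_span ⟨j, rfl⟩
  exact zsmul_mem hj _

theorem mem_span_int_of_mem_span_ringOfIntegers {β : F}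
    (hmax : ∀ x : F, IsIntegral ℤ x → x ∈ Algebra.adjoin ℤ {β}) {κ : Type*} {w : κ → F}
    (hβ : ∀ i, β * w i ∈ Submodule.span ℤ (Set.range w)) {x : F}
    (hx : x ∈ Submodule.span (𝓞 F) (Set.range w)) : x ∈ Submodule.span ℤ (Set.range w) := by
  induction hx using Submodule.span_induction with
  | mem x hx => exact Submodule.subset_span hx
  | zero => simp
  | add a b _ _ ha hb => exact add_mem ha hb
  | smul r a _ ha =>
    rw [Algebra.smul_def]
    exact mul_mem_span_of_mem_adjoin hβ (hmax _ r.2) ha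

theorem mem_spanFinset_univ_iff {κ : Type*} [Fintype κ] [NumberField F] {w : κ → F} {x : F} :
    x ∈ FractionalIdeal.spanFinset (𝓞 F) Finset.univ w ↔
      x ∈ Submodule.span (𝓞 F) (Set.range w) := by
  rw [← FractionalIdeal.mem_coe, FractionalIdeal.spanFinset_coe, Finset.coe_univ, Set.image_univ]

variable [NumberField F]

/-- An order generated by an element of squarefree discriminant is maximal. -/
theorem mem_adjoin_of_squarefree_discr (pb : PowerBasis ℚ F) (hint : IsIntegral ℤ pb.gen) {D : ℤ}
    (hD : Algebra.discr ℚ pb.basis = D) (hsf : Squarefree D) {x : F} (hx : IsIntegral ℤ x) :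
    x ∈ Algebra.adjoin ℤ {pb.gen} := by
  let b := RingOfIntegers.basis F
  let e : Fin pb.dim ≃ Free.ChooseBasisIndex ℤ (𝓞 F) := Fintype.equivOfCardEq (by
    rw [Fintype.card_fin, ← pb.finrank, ← RingOfIntegers.rank F, finrank_eq_card_chooseBasisIndex])
  let g : 𝓞 F := ⟨pb.gen, hint⟩
  let v : Free.ChooseBasisIndex ℤ (𝓞 F) → 𝓞 F := fun i => g ^ (e.symm i : ℕ)
  have hv (j) : algebraMap (𝓞 F) F (v j) = pb.gen ^ (e.symm j : ℕ) := map_pow _ _ _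
  let P := b.toMatrix v
  have hP : ∀ j, v j = ∑ i, P i j • b i := fun j => (b.sum_toMatrix_smul_self v j).symm
  have hdet : P.det * P.det ∣ D := by
    have h1 : integralBasis F ᵥ* (P.map (Int.cast : ℤ → ℚ)).map (algebraMap ℚ F)
        = pb.basis ∘ e.symm := by
      ext j
      have := congrArg (algebraMap (𝓞 F) F) (hP j)
      simp only [map_sum] at this
      simp only [Function.comp, PowerBasis.coe_basis, vecMul, dotProduct]
      rw [← hv, this]
      refine Finset.sum_congr rfl fun i _ => ?_
      simp [b, mul_comm]
    have h2 := Algebra.discr_of_matrix_vecMul (A := ℚ) (integralBasis F)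
      (P.map (Int.cast : ℤ → ℚ))
    rw [h1, Algebra.discr_reindex, hD, ← coe_discr] at h2
    refine ⟨discr F, ?_⟩
    have h3 : (P.map (Int.cast : ℤ → ℚ)).det = (P.det : ℚ) := (Int.cast_det P).symm
    rw [h3, pow_two] at h2
    exact_mod_cast h2
  have hu : IsUnit P.det := hsf _ hdet
  have hb : ∀ i, (b i : F) ∈ Algebra.adjoin ℤ {pb.gen} := by
    intro i
    have h1 : b i = ∑ j, P⁻¹ j i • v j := by
      have h4 (k) : ∑ j, P k j * P⁻¹ j i = (1 : Matrix _ _ ℤ) k i := by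
        rw [← mul_apply, mul_nonsing_inv _ hu]
      simp_rw [hP, Finset.smul_sum, smul_smul]
      rw [Finset.sum_comm]
      simp_rw [← Finset.sum_smul, mul_comm (P⁻¹ _ _), h4, one_apply]
      simp
    rw [h1]
    have h5 : ((∑ j, P⁻¹ j i • v j : 𝓞 F) : F) = ∑ j, P⁻¹ j i • pb.gen ^ (e.symm j : ℕ) := by
      simp [← hv]
    rw [h5]
    exact sum_mem fun j _ => Subalgebra.smul_mem _
      (pow_mem (Algebra.subset_adjoin (Set.mem_singleton _)) _) _
  have hx' : x = ∑ i, b.repr ⟨x, hx⟩ i • (b i : F) := by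
    have := congrArg (algebraMap (𝓞 F) F) (b.sum_repr ⟨x, hx⟩)
    rw [map_sum] at this
    simp only [map_zsmul] at this
    exact this.symm
  rw [hx']
  exact sum_mem fun i _ => Subalgebra.smul_mem _ (hb i) _

end NumberField

section Core

open Module NumberField nonZeroDivisors

variable {F : Type*} [Field F] {ι κ : Type*} [Fintype ι]

theorem linearIndependent_of_mulVec_eq_smul [NumberField F] {β : F}
    (hgen : Algebra.adjoin ℚ {β} = ⊤)
    (hcard : Fintype.card ι = finrank ℚ F) {X : Matrix ι ι ℤ} {u : ι → F} (hu : u ≠ 0)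
    (hXu : X.map (Int.cast : ℤ → F) *ᵥ u = β • u) : LinearIndependent ℚ u := by
  refine linearIndependent_of_top_le_span_of_card_eq_finrank ?_ hcard
  obtain ⟨i₀, hi₀⟩ := Function.ne_iff.1 hu
  have hβ := mul_mem_span_of_mulVec_eq ℚ hXu
  intro a _
  have := mul_mem_span_of_mem_adjoin hβ (y := a / u i₀) (by simp [hgen])
    (Submodule.subset_span ⟨i₀, rfl⟩)
  rwa [div_mul_cancel₀ _ hi₀] at this

theorem eq_of_map_mulVec_eq [CharZero F] {u : ι → F} (hu : LinearIndependent ℚ u)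
    {C C' : Matrix κ ι ℚ}
    (h : C.map (algebraMap ℚ F) *ᵥ u = C'.map (algebraMap ℚ F) *ᵥ u) : C = C' := by
  ext i j
  have h1 : ∑ j, C i j • u j = ∑ j, C' i j • u j := by
    simpa [mulVec, dotProduct, Algebra.smul_def] using congrFun h i
  exact Fintype.linearIndependent_iffₛ.1 hu _ _ h1 j

variable [DecidableEq ι]

theorem map_aeval_mulVec [CharZero F] {β : F} {X : Matrix ι ι ℚ} {u : ι → F}
    (hXu : X.map (algebraMap ℚ F) *ᵥ u = β • u) (p : ℚ[X]) :
    (aeval X p).map (algebraMap ℚ F) *ᵥ u = aeval β p • u := by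
  have hpow (k : ℕ) : (X ^ k).map (algebraMap ℚ F) *ᵥ u = β ^ k • u := by
    induction k with
    | zero => simp
    | succ k ih =>
      rw [pow_succ', Matrix.map_mul, ← mulVec_mulVec, ih, mulVec_smul, hXu, smul_smul, ← pow_succ]
  induction p using Polynomial.induction_on' with
  | add p q hp hq =>
    rw [map_add, map_add, Matrix.map_add _ (map_add _), add_mulVec, hp, hq, add_smul]
  | monomial k c =>
    rw [aeval_monomial, aeval_monomial, ← Algebra.smul_def, mul_smul, ← hpow, ← smul_mulVec]
    congr 1
    ext i j
    simp

theorem isIntegral_of_int_mulVec_eq {a : F} {u : ι → F} (hu : u ≠ 0) {P : Matrix ι ι ℤ}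
    (h : P.map (Int.cast : ℤ → F) *ᵥ u = a • u) : IsIntegral ℤ a := by
  refine ⟨P.charpoly, P.charpoly_monic, ?_⟩
  rw [← eval_map, ← charpoly_map, eval_charpoly]
  refine exists_mulVec_eq_zero_iff.1 ⟨u, hu, ?_⟩
  rw [sub_mulVec, sub_eq_zero]
  refine Eq.trans ?_ h.symm
  ext i
  simp [mulVec_diagonal]

variable [NumberField F]

theorem map_intCast_eq {μ ν : Type*} (P : Matrix μ ν ℤ) :
    P.map (Int.cast : ℤ → F) = (P.map (Int.cast : ℤ → ℚ)).map (algebraMap ℚ F) := by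
  ext; simp

variable [Fintype κ] [DecidableEq κ]

theorem isIntegral_sq_of_mulVec_eq {β a : F} (hgen : Algebra.adjoin ℚ {β} = ⊤) {X : Matrix ι ι ℤ}
    (hX : X.IsSymm) {u : ι → F} (hu : u ≠ 0) (hind : LinearIndependent ℚ u)
    (hXu : (X.map (Int.cast : ℤ → ℚ)).map (algebraMap ℚ F) *ᵥ u = β • u)
    {Q : Matrix ι κ ℚ} (hQ : Qᵀ * Q = 1) {P : Matrix ι κ ℤ}
    (hP : P.map (Int.cast : ℤ → F) *ᵥ (Qᵀ.map (algebraMap ℚ F) *ᵥ u) = a • u) :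
    IsIntegral ℤ (a ^ 2) := by
  let C : Matrix ι ι ℚ := P.map (Int.cast : ℤ → ℚ) * Qᵀ
  have hC : C = P.map (Int.cast : ℤ → ℚ) * Qᵀ := rfl
  have hCu : C.map (algebraMap ℚ F) *ᵥ u = a • u := by
    rw [hC, Matrix.map_mul, ← mulVec_mulVec, ← map_intCast_eq, hP]
  obtain ⟨p, hp⟩ : ∃ p : ℚ[X], aeval β p = a := by
    have : a ∈ Algebra.adjoin ℚ {β} := by simp [hgen]
    rwa [Algebra.adjoin_singleton_eq_range_aeval] at this
  have hCp : C = aeval (X.map (Int.cast : ℤ → ℚ)) p :=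
    eq_of_map_mulVec_eq hind (by rw [hCu, map_aeval_mulVec hXu, hp])
  have hCs : C.IsSymm := by
    rw [hCp]
    exact Matrix.IsSymm.aeval (hX.map _) p
  have hCC : C * C = (P * Pᵀ).map (Int.cast : ℤ → ℚ) := by
    nth_rewrite 2 [← hCs.eq]
    rw [hC, transpose_mul, transpose_transpose, Matrix.mul_assoc, ← Matrix.mul_assoc Qᵀ, hQ,
      Matrix.one_mul, ← transpose_map]
    exact (Matrix.map_mul (f := Int.castRingHom ℚ)).symm
  refine isIntegral_of_int_mulVec_eq hu (P := P * Pᵀ) ?_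
  rw [map_intCast_eq, ← hCC, Matrix.map_mul, ← mulVec_mulVec, hCu, mulVec_smul, hCu, smul_smul,
    pow_two]

/-- A rational orthogonal intertwiner from a symmetric integer matrix generating a maximal
order is integral. -/
theorem exists_int_map_eq_of_orthogonal {β : F}
    (hmax : ∀ x : F, IsIntegral ℤ x → x ∈ Algebra.adjoin ℤ {β})
    (hgen : Algebra.adjoin ℚ {β} = ⊤) (hcard : Fintype.card ι = finrank ℚ F)
    {X : Matrix ι ι ℤ} {Y : Matrix κ κ ℤ} (hX : X.IsSymm) (hY : Y.IsSymm)
    {u : ι → F} (hu : u ≠ 0) (hXu : X.map (Int.cast : ℤ → F) *ᵥ u = β • u)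
    {Q : Matrix ι κ ℚ} (hQ : Qᵀ * Q = 1) (hQ' : Q * Qᵀ = 1)
    (hXQ : X.map (Int.cast : ℤ → ℚ) * Q = Q * Y.map (Int.cast : ℤ → ℚ)) :
    ∃ R : Matrix ι κ ℤ, Q = R.map (Int.cast : ℤ → ℚ) := by
  have hind := linearIndependent_of_mulVec_eq_smul hgen hcard hu hXu
  have hXu' : (X.map (Int.cast : ℤ → ℚ)).map (algebraMap ℚ F) *ᵥ u = β • u := by
    rw [← map_intCast_eq, hXu]
  set w : κ → F := Qᵀ.map (algebraMap ℚ F) *ᵥ u with hw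
  have hYw : Y.map (Int.cast : ℤ → F) *ᵥ w = β • w := by
    have h1 : Y.map (Int.cast : ℤ → ℚ) * Qᵀ = Qᵀ * X.map (Int.cast : ℤ → ℚ) := by
      have := congrArg transpose hXQ
      rw [transpose_mul, transpose_mul, ← transpose_map, ← transpose_map, hX.eq, hY.eq] at this
      exact this.symm
    rw [hw, ← mulVec_smul, ← hXu', mulVec_mulVec, mulVec_mulVec, ← Matrix.map_mul, ← h1,
      Matrix.map_mul, ← map_intCast_eq]
  have huw : Q.map (algebraMap ℚ F) *ᵥ w = u := by
    rw [hw, mulVec_mulVec, ← Matrix.map_mul, hQ']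
    simp
  have hw0 : w ≠ 0 := by
    intro h; rw [h, mulVec_zero] at huw; exact hu huw.symm
  let I : FractionalIdeal (𝓞 F)⁰ F := FractionalIdeal.spanFinset (𝓞 F) Finset.univ u
  let J : FractionalIdeal (𝓞 F)⁰ F := FractionalIdeal.spanFinset (𝓞 F) Finset.univ w
  have hI0 : I ≠ 0 := by
    obtain ⟨i, hi⟩ := Function.ne_iff.1 hu
    exact FractionalIdeal.spanFinset_ne_zero.2 ⟨i, Finset.mem_univ _, hi⟩
  have uI (i) : u i ∈ I := mem_spanFinset_univ_iff.2 (Submodule.subset_span ⟨i, rfl⟩)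
  have wJ (i) : w i ∈ J := mem_spanFinset_univ_iff.2 (Submodule.subset_span ⟨i, rfl⟩)
  have hJI : J * I⁻¹ * I = J := by rw [mul_assoc, inv_mul_cancel₀ hI0, mul_one]
  have hle : J * I⁻¹ ≤ 1 := by
    intro a ha
    have ha' (i) : a * u i ∈ Submodule.span ℤ (Set.range w) :=
      mem_span_int_of_mem_span_ringOfIntegers hmax (mul_mem_span_of_mulVec_eq ℤ hYw)
        (mem_spanFinset_univ_iff.1 (hJI.le (FractionalIdeal.mul_mem_mul ha (uI i))))
    obtain ⟨P, hP⟩ := exists_int_matrix_of_mem_span ha'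
    have haa : IsIntegral ℤ (a ^ 2) :=
      isIntegral_sq_of_mulVec_eq hgen hX hu hind hXu' hQ (P := P) (a := a) hP.symm
    have haI : IsIntegral ℤ a := haa.of_pow two_pos
    exact (FractionalIdeal.mem_one_iff _).2 ⟨⟨a, haI⟩, rfl⟩
  have hJle : J ≤ I := by
    rw [← hJI]
    exact (mul_le_mul_left hle I).trans_eq (one_mul I)
  obtain ⟨R, hR⟩ := exists_int_matrix_of_mem_span fun i =>
    mem_span_int_of_mem_span_ringOfIntegers hmax (mul_mem_span_of_mulVec_eq ℤ hXu)
      (mem_spanFinset_univ_iff.1 (hJle (wJ i)))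
  refine ⟨Rᵀ, ?_⟩
  have : Qᵀ = R.map (Int.cast : ℤ → ℚ) :=
    eq_of_map_mulVec_eq hind (by rw [← hw, hR, map_intCast_eq (F := F)])
  rw [← transpose_transpose Q, this]
  rfl

end Core

section Discriminant

open Module

theorem rootsEnum_spec {n : ℕ} {f : ℂ[X]} (hn : f.natDegree = n) :
    f.roots = Multiset.map (rootsEnum n f) Finset.univ.val := by
  have h : ∃ α : Fin n → ℂ, f.roots = Multiset.map α Finset.univ.val := by
    have hc : f.roots.toList.length = n := by
      rw [Multiset.length_toList, ← hn]
      exact (IsAlgClosed.splits f).natDegree_eq_card_roots.symm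
    subst hc
    refine ⟨f.roots.toList.get, ?_⟩
    conv_lhs => rw [← Multiset.coe_toList f.roots, ← List.ofFn_get f.roots.toList]
    exact (Fin.univ_val_map _).symm
  rw [rootsEnum, dif_pos h]
  exact h.choose_spec

theorem polyDisc_eq_prod_roots {n : ℕ} {f : ℂ[X]} (hf : f.Monic) (hn : f.natDegree = n) :
    ∃ ε : ℤ, polyDisc n f = ε * (f.roots.map fun a => f.derivative.eval a).prod := by
  have hα := rootsEnum_spec hn
  set α := rootsEnum n f with hαdef
  have h1 (i : Fin n) : f.derivative.eval (α i) = ∏ j ∈ {i}ᶜ, (α i - α j) := by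
    rw [(IsAlgClosed.splits f).eval_root_derivative hf
      (by rw [hα]; exact Multiset.mem_map_of_mem _ (Finset.mem_univ_val i)), hα,
      ← Multiset.map_erase_of_mem _ _ (Finset.mem_univ_val i), Multiset.map_map,
      ← Finset.erase_val, Finset.compl_singleton]
    rfl
  have h2 : (f.roots.map fun a => f.derivative.eval a).prod
      = (∏ i : Fin n, ∏ _j ∈ Finset.Ioi i, (-1 : ℂ)) * polyDisc n f := by
    rw [hα, Multiset.map_map]
    change ∏ i, f.derivative.eval (α i) = _
    simp_rw [h1]
    rw [← Finset.prod_prod_Ioi_mul_eq_prod_prod_off_diag fun j i => α i - α j, polyDisc,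
      ← Finset.prod_mul_distrib]
    refine Finset.prod_congr rfl fun i _ => ?_
    have : Finset.univ.filter (fun j => i < j) = Finset.Ioi i := by ext; simp
    rw [this, ← Finset.prod_mul_distrib]
    refine Finset.prod_congr rfl fun j _ => ?_
    rw [← hαdef]
    ring
  refine ⟨∏ i : Fin n, ∏ _j ∈ Finset.Ioi i, (-1 : ℤ), ?_⟩
  rw [h2, ← mul_assoc]
  push_cast
  simp_rw [← Finset.prod_mul_distrib]
  simp

theorem prod_roots_expand_two {g : ℂ[X]} (hg : g.Monic) :
    ((expand ℂ 2 g).roots.map fun a => (expand ℂ 2 g).derivative.eval a).prod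
      = 4 ^ g.natDegree * g.eval 0 * (g.roots.map fun b => g.derivative.eval b).prod ^ 2 := by
  choose r hr using fun b : ℂ => IsAlgClosed.exists_pow_nat_eq b two_pos
  have hs := (IsAlgClosed.splits g).eq_prod_roots_of_monic hg
  have hroots : (expand ℂ 2 g).roots = g.roots.map r + g.roots.map fun b => - r b := by
    rw [← roots_multiset_prod_X_sub_C (g.roots.map r + g.roots.map fun b => - r b)]
    congr 1
    conv_lhs => rw [hs]
    rw [map_multiset_prod, Multiset.map_add, Multiset.prod_add, Multiset.map_map,
      Multiset.map_map, Multiset.map_map, ← Multiset.prod_map_mul]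
    congr 1
    refine Multiset.map_congr rfl fun b _ => ?_
    have : (C b : ℂ[X]) = C (r b) ^ 2 := by rw [← C_pow, hr]
    simp only [Function.comp, map_sub, expand_X, expand_C, map_neg]
    rw [this]
    ring
  have heval : g.eval 0 = (g.roots.map fun b => -b).prod := by
    conv_lhs => rw [hs]
    rw [eval_multiset_prod, Multiset.map_map]
    simp
  have hcard : (4 : ℂ) ^ g.natDegree = (g.roots.map fun _ => (4 : ℂ)).prod := by
    rw [(IsAlgClosed.splits g).natDegree_eq_card_roots]
    simp
  rw [hroots, Multiset.map_add, Multiset.prod_add, Multiset.map_map, Multiset.map_map,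
    ← Multiset.prod_map_mul, heval, hcard, ← Multiset.prod_map_pow, ← Multiset.prod_map_mul,
    ← Multiset.prod_map_mul]
  congr 1
  refine Multiset.map_congr rfl fun b _ => ?_
  simp only [Function.comp, derivative_expand, eval_mul, expand_eval, neg_sq, hr, eval_pow, eval_X,
    eval_natCast]
  push_cast
  linear_combination (-4 * (g.derivative.eval b) ^ 2) * hr b

theorem norm_aeval_gen_eq_prod_roots {F : Type*} [Field F] [NumberField F] (pb : PowerBasis ℚ F)
    (p : ℚ[X]) : ((Algebra.norm ℚ (aeval pb.gen p) : ℚ) : ℂ)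
      = (((minpoly ℚ pb.gen).map (algebraMap ℚ ℂ)).roots.map fun b => aeval b p).prod := by
  have h := Algebra.norm_eq_prod_embeddings ℚ ℂ (aeval pb.gen p)
  have hnodup : ((minpoly ℚ pb.gen).aroots ℂ).Nodup :=
    nodup_roots (Separable.map (Algebra.IsSeparable.isSeparable ℚ pb.gen))
  rw [eq_ratCast] at h
  rw [h]
  simp_rw [← aeval_algHom_apply]
  rw [Fintype.prod_equiv pb.liftEquiv' (fun σ : F →ₐ[ℚ] ℂ => aeval (σ pb.gen) p)
    (fun x => aeval (x : ℂ) p) fun σ => by rw [PowerBasis.liftEquiv'_apply_coe],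
    Finset.prod_mem_multiset _ _ (fun b => aeval b p) fun _ => rfl,
    Finset.prod_eq_multiset_prod, Multiset.toFinset_val, Multiset.dedup_eq_self.2 hnodup]

theorem squarefree_of_sq_eq_mul_sq {d ε D : ℤ} (hd : Squarefree d) (h : d ^ 2 = ε * D ^ 2) :
    Squarefree D :=
  hd.squarefree_of_dvd ((Int.pow_dvd_pow_iff two_ne_zero).1 (h ▸ dvd_mul_left _ _))

variable {ι κ : Type*} [Fintype ι] [Fintype κ] [DecidableEq ι] [DecidableEq κ]

theorem charpoly_map_intCast (R : Type*) [CommRing R] (X : Matrix ι ι ℤ) :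
    (X.map (Int.cast : ℤ → R)).charpoly = X.charpoly.map (algebraMap ℤ R) :=
  charpoly_map X (algebraMap ℤ R)

theorem exists_int_map_eq_of_minpoly_eq_charpoly {F : Type*} [Field F] [NumberField F]
    (pb : PowerBasis ℚ F) {X : Matrix ι ι ℤ} {Y : Matrix κ κ ℤ} (hX : X.IsSymm) (hY : Y.IsSymm)
    (hmin : minpoly ℚ pb.gen = (X.map (Int.cast : ℤ → ℚ)).charpoly)
    {d c : ℤ} (hd : Squarefree d)
    (h : (d : ℂ) ^ 2 = c * ((X.map (Int.cast : ℤ → ℂ)).charpoly.roots.map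
      fun b => (X.map (Int.cast : ℤ → ℂ)).charpoly.derivative.eval b).prod ^ 2)
    {Q : Matrix ι κ ℚ} (hQ : Qᵀ * Q = 1) (hQ' : Q * Qᵀ = 1)
    (hXQ : X.map (Int.cast : ℤ → ℚ) * Q = Q * Y.map (Int.cast : ℤ → ℚ)) :
    ∃ R : Matrix ι κ ℤ, Q = R.map (Int.cast : ℤ → ℚ) := by
  have hcard : Fintype.card ι = finrank ℚ F := by
    rw [pb.finrank, ← pb.natDegree_minpoly, hmin, charpoly_natDegree_eq_dim]
  rw [charpoly_map_intCast] at hmin h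
  have hroot : aeval pb.gen X.charpoly = 0 := by
    rw [← aeval_map_algebraMap ℚ, ← hmin, minpoly.aeval]
  have hint : IsIntegral ℤ pb.gen := ⟨X.charpoly, charpoly_monic _, hroot⟩
  have hder : IsIntegral ℤ (aeval pb.gen X.charpoly.derivative) := by
    rw [aeval_eq_sum_range]
    exact IsIntegral.sum _ fun i _ => (hint.pow i).smul _
  obtain ⟨D, hD⟩ := IsIntegrallyClosed.isIntegral_iff.1 (Algebra.isIntegral_norm ℚ hder)
  rw [eq_intCast] at hD
  have hDC := norm_aeval_gen_eq_prod_roots pb (minpoly ℚ pb.gen).derivative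
  have hdiscr := Algebra.discr_powerBasis_eq_norm ℚ pb
  simp only [hmin, derivative_map, aeval_map_algebraMap, Polynomial.map_map, ← hD,
    Rat.cast_intCast, ← IsScalarTower.algebraMap_eq] at hDC hdiscr
  have hDsf : Squarefree D := by
    simp only [derivative_map, eval_map_algebraMap, ← hDC] at h
    exact squarefree_of_sq_eq_mul_sq hd (by exact_mod_cast h)
  have hsf : Squarefree ((-1) ^ (finrank ℚ F * (finrank ℚ F - 1) / 2) * D) := by
    rcases neg_one_pow_eq_or ℤ (finrank ℚ F * (finrank ℚ F - 1) / 2) with h1 | h1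
    · rwa [h1, one_mul]
    · rwa [h1, neg_one_mul, Int.squarefree_natAbs.symm, Int.natAbs_neg, Int.squarefree_natAbs]
  obtain ⟨u, hu, hXu⟩ : ∃ u : ι → F, u ≠ 0 ∧
      (Matrix.scalar ι pb.gen - X.map (Int.cast : ℤ → F)) *ᵥ u = 0 := by
    refine exists_mulVec_eq_zero_iff.2 ?_
    rw [← eval_charpoly, charpoly_map_intCast, eval_map_algebraMap, hroot]
  rw [sub_mulVec, sub_eq_zero] at hXu
  refine exists_int_map_eq_of_orthogonal (fun x hx => mem_adjoin_of_squarefree_discr pb hint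
    (by exact_mod_cast hdiscr) hsf hx) pb.adjoin_gen_eq_top hcard hX hY hu (hXu.symm.trans ?_)
    hQ hQ' hXQ
  ext i
  simp [mulVec_diagonal]

theorem exists_int_map_eq_of_irreducible {X : Matrix ι ι ℤ} {Y : Matrix κ κ ℤ}
    (hX : X.IsSymm) (hY : Y.IsSymm) (hirr : Irreducible (X.map (Int.cast : ℤ → ℚ)).charpoly)
    {d c : ℤ} (hd : Squarefree d)
    (h : (d : ℂ) ^ 2 = c * ((X.map (Int.cast : ℤ → ℂ)).charpoly.roots.map
      fun b => (X.map (Int.cast : ℤ → ℂ)).charpoly.derivative.eval b).prod ^ 2)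
    {Q : Matrix ι κ ℚ} (hQ : Qᵀ * Q = 1) (hQ' : Q * Qᵀ = 1)
    (hXQ : X.map (Int.cast : ℤ → ℚ) * Q = Q * Y.map (Int.cast : ℤ → ℚ)) :
    ∃ R : Matrix ι κ ℤ, Q = R.map (Int.cast : ℤ → ℚ) := by
  have : Fact (Irreducible (X.map (Int.cast : ℤ → ℚ)).charpoly) := ⟨hirr⟩
  have hmonic := charpoly_monic (X.map (Int.cast : ℤ → ℚ))
  let pb := AdjoinRoot.powerBasis hmonic.ne_zero
  have : FiniteDimensional ℚ (AdjoinRoot (X.map (Int.cast : ℤ → ℚ)).charpoly) := pb.finite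
  have : CharZero (AdjoinRoot (X.map (Int.cast : ℤ → ℚ)).charpoly) :=
    charZero_of_injective_algebraMap (algebraMap ℚ _).injective
  have : NumberField (AdjoinRoot (X.map (Int.cast : ℤ → ℚ)).charpoly) := ⟨⟩
  refine exists_int_map_eq_of_minpoly_eq_charpoly pb hX hY ?_ hd h hQ hQ' hXQ
  refine (AdjoinRoot.minpoly_root hmonic.ne_zero).trans ?_
  rw [hmonic.leadingCoeff, inv_one, C_1, mul_one]

end Discriminant

section Bipartite

variable {R ι κ : Type*} [CommRing R] [Fintype ι] [Fintype κ] [DecidableEq ι] [DecidableEq κ]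

theorem expand_two_charpoly_mul_self (A : Matrix ι ι R) :
    expand R 2 (A * A).charpoly = A.charpoly * (-A).charpoly := by
  rw [Matrix.charpoly, Matrix.charpoly, Matrix.charpoly, ← det_mul, AlgHom.map_det]
  congr 1
  have h1 : (expand R 2).mapMatrix (charmatrix (A * A))
      = Matrix.scalar ι (X ^ 2 : R[X]) - A.map C * A.map C := by
    ext1 i j
    have hC : C ((A * A) i j) = (A.map C * A.map C) i j :=
      congrFun₂ (Matrix.map_mul (f := (C : R →+* R[X]))) i j
    by_cases hij : i = j
    · subst hij; simp [← hC]
    · simp [hij, ← hC]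
  rw [h1, charmatrix, charmatrix]
  have h2 : C.mapMatrix (-A) = - A.map (C : R →+* R[X]) := by ext1; simp
  have h3 := (Matrix.scalar_commute (X : R[X]) (fun r => Commute.all _ r)
    (A.map (C : R →+* R[X]))).eq
  rw [h2, RingHom.mapMatrix_apply, map_pow]
  rw [sub_neg_eq_add, sub_mul, mul_add, mul_add, h3, pow_two]
  abel

theorem charpoly_eq_mul_of_toBlock_eq_zero (N : Matrix ι ι R) (p : ι → Prop) [DecidablePred p]
    (h : N.toBlock (fun i => ¬ p i) p = 0) :
    N.charpoly = (N.toBlock p p).charpoly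
      * (N.toBlock (fun i => ¬ p i) fun i => ¬ p i).charpoly := by
  have hc (q : ι → Prop) [DecidablePred q] :
      charmatrix (N.toBlock q q) = (charmatrix N).toSquareBlockProp q := by
    ext1 i j
    by_cases hij : i = j
    · subst hij; simp [toSquareBlockProp]
    · simp [toSquareBlockProp, hij, Subtype.coe_injective.ne hij]
  rw [Matrix.charpoly, Matrix.charpoly, Matrix.charpoly, hc, hc]
  convert twoBlockTriangular_det (charmatrix N) p fun i hi j hj => ?_
  have hij : i ≠ j := by rintro rfl; exact hi hj
  have h0 : N i j = 0 := congrFun₂ h ⟨i, hi⟩ ⟨j, hj⟩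
  rw [charmatrix_apply_ne _ _ _ hij, h0, C_0, neg_zero]

theorem eq_of_X_pow_mul_eq [IsDomain R] {p q : R[X]} {a b : ℕ} (h : X ^ a * p = X ^ b * q)
    (hp : p.coeff 0 ≠ 0) (hq : q.coeff 0 ≠ 0) : p = q := by
  wlog hab : a ≤ b generalizing a b p q
  · exact (this h.symm hq hp (le_of_not_ge hab)).symm
  obtain ⟨k, rfl⟩ := Nat.exists_eq_add_of_le hab
  rw [pow_add, mul_assoc] at h
  have h1 := mul_left_cancel₀ (pow_ne_zero _ X_ne_zero) h
  rcases k.eq_zero_or_pos with rfl | hk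
  · simpa using h1
  · rw [h1, mul_coeff_zero, coeff_X_pow] at hp
    simp [hk.ne] at hp

variable {A : Matrix ι ι R} {p : ι → Prop} [DecidablePred p]

theorem toBlock_mul_self (h : ∀ i j, A i j ≠ 0 → (p i ↔ ¬ p j)) :
    (A * A).toBlock (fun i => ¬ p i) p = 0 ∧
    (A * A).toBlock p p = A.toBlock p (fun i => ¬ p i) * A.toBlock (fun i => ¬ p i) p ∧
    (A * A).toBlock (fun i => ¬ p i) (fun i => ¬ p i)
      = A.toBlock (fun i => ¬ p i) p * A.toBlock p (fun i => ¬ p i) := by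
  have h1 : A.toBlock p p = 0 := by
    ext i j
    by_contra h0
    exact (h i j h0).1 i.2 j.2
  have h2 : A.toBlock (fun i => ¬ p i) (fun i => ¬ p i) = 0 := by
    ext i j
    by_contra h0
    exact i.2 ((h i j h0).2 j.2)
  refine ⟨?_, ?_, ?_⟩ <;> rw [toBlock_mul_eq_add _ p] <;> simp [h1, h2]

variable (R p) in
/-- The diagonal sign matrix of a partition. -/
def partitionSign : Matrix ι ι R := diagonal fun i => if p i then 1 else -1

theorem partitionSign_mul_self : partitionSign R p * partitionSign R p = 1 := by
  rw [partitionSign, diagonal_mul_diagonal, ← diagonal_one]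
  congr 1
  ext i
  split_ifs <;> simp

theorem partitionSign_mul (h : ∀ i j, A i j ≠ 0 → (p i ↔ ¬ p j)) :
    partitionSign R p * A = -(A * partitionSign R p) := by
  ext i j
  rw [partitionSign, Matrix.neg_apply, mul_diagonal, diagonal_mul]
  by_cases h0 : A i j = 0
  · simp [h0]
  · have := h i j h0
    by_cases hi : p i <;> by_cases hj : p j <;> simp_all

theorem charpoly_neg_eq_of_bipartite (h : ∀ i j, A i j ≠ 0 → (p i ↔ ¬ p j)) :
    (-A).charpoly = A.charpoly := by
  have hA : -A = partitionSign R p * A * partitionSign R p := by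
    rw [partitionSign_mul h, Matrix.neg_mul, Matrix.mul_assoc, partitionSign_mul_self,
      Matrix.mul_one]
  rw [hA, charpoly_mul_comm, ← Matrix.mul_assoc, partitionSign_mul_self, Matrix.one_mul]

theorem charpoly_eq_expand_two [IsDomain R] (hdet : A.det ≠ 0)
    (h : ∀ i j, A i j ≠ 0 → (p i ↔ ¬ p j)) :
    A.charpoly = expand R 2 ((A * A).toBlock p p).charpoly := by
  obtain ⟨h1, h2, h3⟩ := toBlock_mul_self h
  have hAA := charpoly_eq_mul_of_toBlock_eq_zero (A * A) p h1
  have h0 : (A * A).charpoly.coeff 0 ≠ 0 := by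
    intro h0
    refine mul_ne_zero hdet hdet ?_
    rw [← det_mul, det_eq_sign_charpoly_coeff, h0, mul_zero]
  rw [hAA, mul_coeff_zero] at h0
  have heq : ((A * A).toBlock p p).charpoly
      = ((A * A).toBlock (fun i => ¬ p i) fun i => ¬ p i).charpoly := by
    refine eq_of_X_pow_mul_eq (a := Fintype.card {i // ¬ p i}) (b := Fintype.card {i // p i}) ?_
      (left_ne_zero_of_mul h0) (right_ne_zero_of_mul h0)
    rw [h2, h3]
    exact charpoly_mul_comm' _ _
  have hsq : A.charpoly ^ 2 = (expand R 2 ((A * A).toBlock p p).charpoly) ^ 2 := by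
    rw [pow_two, pow_two]
    nth_rewrite 2 [← charpoly_neg_eq_of_bipartite h]
    rw [← expand_two_charpoly_mul_self, hAA, ← heq, map_mul]
  rcases sq_eq_sq_iff_eq_or_eq_neg.1 hsq with h4 | h4
  · exact h4
  · have h5 := congrArg leadingCoeff h4
    rw [leadingCoeff_neg, (charpoly_monic A).leadingCoeff,
      ((charpoly_monic _).expand two_pos).leadingCoeff] at h5
    rw [h4, ← neg_one_mul, ← C_1, ← C_neg, ← h5, C_1, one_mul]

end Bipartite

section Trees

variable {V : Type*} {T : SimpleGraph V}

/-- Every signing of the edges of a tree is switching equivalent to the trivial one. -/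
theorem SimpleGraph.IsTree.exists_switching (hT : T.IsTree) {a : V → V → ℤ}
    (hsymm : ∀ u v, a u v = a v u) (ha : ∀ u v, T.Adj u v → a u v = 1 ∨ a u v = -1) :
    ∃ s : V → ℤ, (∀ v, s v = 1 ∨ s v = -1) ∧ ∀ u v, T.Adj u v → a u v = s u * s v := by
  obtain ⟨r⟩ := hT.connected.nonempty
  choose P hP using fun v => (hT.existsUnique_path r v).exists
  let s : V → ℤ := fun v => ((P v).darts.map fun e => a e.fst e.snd).prod
  have hs (v : V) : s v = 1 ∨ s v = -1 := by
    rw [← Int.isUnit_iff]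
    refine (IsUnit.submonoid ℤ).list_prod_mem fun x hx => ?_
    obtain ⟨e, -, rfl⟩ := List.mem_map.1 hx
    exact Int.isUnit_iff.2 (ha _ _ e.adj)
  have hconcat {u v : V} (huv : T.Adj u v) (hu : u ∈ (P v).support) : a u v = s u * s v := by
    have hv : s v = s u * a u v := by
      simp only [s]
      rw [hT.isAcyclic.path_concat (hP u) (hP v) huv hu]
      simp
    rw [hv, ← mul_assoc]
    rcases hs u with h | h <;> simp [h]
  refine ⟨s, hs, fun u v huv => ?_⟩
  by_cases hu : u ∈ (P v).support
  · exact hconcat huv hu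
  · rw [hsymm, mul_comm]
    exact hconcat huv.symm
      (hT.isAcyclic.mem_support_of_ne_mem_support_of_adj_of_isPath (hP u) (hP v) huv hu)

theorem SimpleGraph.IsTree.charpoly_eq_of_isSignedAdjMatrix {n : ℕ} {T : SimpleGraph (Fin n)}
    [DecidableRel T.Adj] (hT : T.IsTree) {A : Matrix (Fin n) (Fin n) ℤ}
    (hA : IsSignedAdjMatrix A) (hAT : ∀ i j, A i j ≠ 0 ↔ T.Adj i j) :
    A.charpoly = (T.adjMatrix ℤ).charpoly := by
  obtain ⟨s, hs, has⟩ := hT.exists_switching (a := A) (fun u v => (hA.1.apply u v).symm)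
    fun u v huv => by
      have := hA.2.2 u v
      have := (hAT u v).2 huv
      tauto
  have hSS : diagonal s * diagonal s = 1 := by
    rw [diagonal_mul_diagonal, ← diagonal_one]
    congr 1
    ext i
    rcases hs i with h | h <;> simp [h]
  have hAS : A = diagonal s * T.adjMatrix ℤ * diagonal s := by
    ext i j
    rw [mul_diagonal, diagonal_mul, SimpleGraph.adjMatrix_apply]
    split_ifs with h
    · rw [has i j h, mul_one]
    · simpa using mt (hAT i j).1 h
  rw [hAS, charpoly_mul_comm, ← Matrix.mul_assoc, hSS, Matrix.one_mul]

end Trees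

section Intertwiner

variable {n : ℕ} {p q : Fin n → Prop} [DecidablePred p] [DecidablePred q]

/-- An orthogonal intertwiner of irreducible bipartite matrices respects the bipartitions. -/
theorem block_of_intertwiner {A B Q : Matrix (Fin n) (Fin n) ℚ} (hA : Irreducible A.charpoly)
    (hAs : A.IsSymm) (hBs : B.IsSymm) (hp : ∀ i j, A i j ≠ 0 → (p i ↔ ¬ p j))
    (hq : ∀ i j, B i j ≠ 0 → (q i ↔ ¬ q j)) (hQ : Qᵀ * Q = 1) (hQ' : Q * Qᵀ = 1)
    (h : A * Q = Q * B) :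
    (∀ i j, Q i j ≠ 0 → (p i ↔ q j)) ∨ (∀ i j, Q i j ≠ 0 → (p i ↔ ¬ q j)) := by
  set S := partitionSign ℚ p with hS
  set S' := partitionSign ℚ q with hS'
  have hSt : Sᵀ = S := diagonal_transpose _
  have hSt' : S'ᵀ = S' := diagonal_transpose _
  have hSS : S * S = 1 := partitionSign_mul_self
  have hSS' : S' * S' = 1 := partitionSign_mul_self
  have hSA : S * A = -(A * S) := partitionSign_mul hp
  have hSB : S' * B = -(B * S') := partitionSign_mul hq
  have hQA : Qᵀ * A = B * Qᵀ := by
    simpa [transpose_mul, hAs.eq, hBs.eq] using congrArg transpose h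
  let Z := S * Q * S' * Qᵀ
  have hZ : Commute Z A := by
    change S * Q * S' * Qᵀ * A = A * (S * Q * S' * Qᵀ)
    calc S * Q * S' * Qᵀ * A = S * Q * (S' * B) * Qᵀ := by
          rw [Matrix.mul_assoc _ Qᵀ, hQA]; simp only [Matrix.mul_assoc]
      _ = -(S * (Q * B) * S' * Qᵀ) := by
          rw [hSB]; simp only [Matrix.mul_assoc, Matrix.mul_neg, Matrix.neg_mul]
      _ = -((S * A) * Q * S' * Qᵀ) := by rw [← h]; simp only [Matrix.mul_assoc]
      _ = A * (S * Q * S' * Qᵀ) := by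
          rw [hSA]; simp only [Matrix.mul_assoc, Matrix.neg_mul, neg_neg]
  have hZZ : Z * Zᵀ = 1 := by
    simp only [Z, transpose_mul, transpose_transpose, hSt, hSt']
    calc S * Q * S' * Qᵀ * (Q * (S' * (Qᵀ * S)))
        = S * (Q * (S' * ((Qᵀ * Q) * S') * Qᵀ)) * S := by simp only [Matrix.mul_assoc]
      _ = 1 := by rw [hQ, Matrix.one_mul, hSS', Matrix.one_mul, hQ', Matrix.mul_one, hSS]
  have hSQ : S * Q * S' = Z * Q := by
    simp only [Z, Matrix.mul_assoc, hQ, Matrix.mul_one]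
  have hij (i j) : (S * Q * S') i j =
      (if p i then 1 else -1) * Q i j * (if q j then 1 else -1) := by
    rw [hS, hS', partitionSign, partitionSign, mul_diagonal, diagonal_mul]
  rcases Matrix.eq_one_or_neg_one_of_commute hA hAs hZ hZZ with hZ1 | hZ1
  · left
    intro i j h0
    have := hij i j
    rw [hSQ, hZ1, Matrix.one_mul] at this
    by_contra hc
    by_cases hi : p i <;> by_cases hj : q j <;> simp only [hi, hj, if_true, if_false] at this hc <;>
      first | exact h0 (by linarith) | simp at hc
  · right
    intro i j h0
    have := hij i j
    rw [hSQ, hZ1, Matrix.neg_mul, Matrix.one_mul, Matrix.neg_apply] at this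
    by_contra hc
    by_cases hi : p i <;> by_cases hj : q j <;> simp only [hi, hj, if_true, if_false] at this hc <;>
      first | exact h0 (by linarith) | simp at hc

/-- Under the discriminant condition, the diagonal blocks of the intertwiner are integral. -/
theorem exists_int_toBlock_eq (hn : n ≠ 1) {A B : Matrix (Fin n) (Fin n) ℤ} (hAs : A.IsSymm)
    (hBs : B.IsSymm) (hA : Irreducible (A.map (Int.cast : ℤ → ℚ)).charpoly)
    (hp : ∀ i j, A i j ≠ 0 → (p i ↔ ¬ p j)) {d : ℤ} (hd : Squarefree d)
    (hdisc : polyDisc n (A.map (Int.cast : ℤ → ℂ)).charpoly = 2 ^ n * (d : ℂ) ^ 2)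
    {Q : Matrix (Fin n) (Fin n) ℚ} (hQ : Qᵀ * Q = 1) (hQ' : Q * Qᵀ = 1)
    (h : A.map (Int.cast : ℤ → ℚ) * Q = Q * B.map (Int.cast : ℤ → ℚ))
    (hpq : ∀ i j, Q i j ≠ 0 → (p i ↔ q j)) :
    ∃ R : Matrix {i // p i} {j // q j} ℤ, Q.toBlock p q = R.map (Int.cast : ℤ → ℚ) := by
  have hdet : A.det ≠ 0 := by
    intro h0
    have h1 : (A.map (Int.cast : ℤ → ℚ)).charpoly.IsRoot 0 := by
      have h2 : (A.map (Int.cast : ℤ → ℚ)).det = 0 := by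
        rw [← Int.cast_det, h0, Int.cast_zero]
      rw [IsRoot, eval_charpoly, map_zero, zero_sub, det_neg, h2, mul_zero]
    have h2 := natDegree_eq_of_degree_eq_some (degree_eq_one_of_irreducible_of_root hA h1)
    rw [charpoly_natDegree_eq_dim, Fintype.card_fin] at h2
    exact hn h2
  set X : Matrix {i // p i} {i // p i} ℤ := (A * A).toBlock p p
  have hexp : A.charpoly = expand ℤ 2 X.charpoly := charpoly_eq_expand_two hdet hp
  have hexpK (K : Type) [CommRing K] : (A.map (Int.cast : ℤ → K)).charpoly
      = expand K 2 (X.map (Int.cast : ℤ → K)).charpoly := by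
    rw [charpoly_map_intCast, charpoly_map_intCast, hexp, map_expand]
  have hdeg : n = 2 * X.charpoly.natDegree := by
    have := congrArg natDegree hexp
    rwa [charpoly_natDegree_eq_dim, Fintype.card_fin, natDegree_expand, mul_comm] at this
  have hXirr : Irreducible (X.map (Int.cast : ℤ → ℚ)).charpoly :=
    of_irreducible_expand two_ne_zero (hexpK ℚ ▸ hA)
  obtain ⟨ε, hε⟩ := polyDisc_eq_prod_roots (charpoly_monic (A.map (Int.cast : ℤ → ℂ)))
    (by rw [charpoly_natDegree_eq_dim, Fintype.card_fin])
  rw [hdisc, hexpK ℂ, prod_roots_expand_two (charpoly_monic _)] at hε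
  have hd2 : (d : ℂ) ^ 2 = (ε * X.charpoly.eval 0 : ℤ) *
      ((X.map (Int.cast : ℤ → ℂ)).charpoly.roots.map
        fun b => (X.map (Int.cast : ℤ → ℂ)).charpoly.derivative.eval b).prod ^ 2 := by
    have h4 : (2 : ℂ) ^ n = 4 ^ (X.map (Int.cast : ℤ → ℂ)).charpoly.natDegree := by
      rw [charpoly_map_intCast, (charpoly_monic X).natDegree_map]
      calc (2 : ℂ) ^ n = 2 ^ (2 * X.charpoly.natDegree) := congrArg _ hdeg
        _ = 4 ^ X.charpoly.natDegree := by rw [pow_mul]; norm_num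
    have h5 : (X.map (Int.cast : ℤ → ℂ)).charpoly.eval 0 = (X.charpoly.eval 0 : ℤ) := by
      rw [charpoly_map_intCast, eval_zero_map, eq_intCast]
    rw [h4, h5] at hε
    refine mul_left_cancel₀ (pow_ne_zero _ (by norm_num : (4 : ℂ) ≠ 0)) (hε.trans ?_)
    push_cast
    ring
  have hsymm {r : Fin n → Prop} {C : Matrix (Fin n) (Fin n) ℤ} (hC : C.IsSymm) :
      ((C * C).toBlock r r).IsSymm := by
    ext i j
    have : (C * C)ᵀ = C * C := by rw [transpose_mul, hC.eq]
    exact congrFun₂ this i j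
  have hblock (K : Type) [CommRing K] {r : Fin n → Prop} (C : Matrix (Fin n) (Fin n) ℤ) :
      ((C * C).toBlock r r).map (Int.cast : ℤ → K)
        = (C.map (Int.cast : ℤ → K) * C.map (Int.cast : ℤ → K)).toBlock r r := by
    rw [← Matrix.map_mul_intCast]
    rfl
  have h1 : Q.toBlock (fun i => ¬ p i) q = 0 := by
    ext i j
    by_contra h0
    exact i.2 ((hpq i j h0).2 j.2)
  have h2 : Q.toBlock p (fun j => ¬ q j) = 0 := by
    ext i j
    by_contra h0
    exact j.2 ((hpq i j h0).1 i.2)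
  refine exists_int_map_eq_of_irreducible (hsymm hAs) (hsymm hBs) hXirr hd hd2 ?_ ?_ ?_
  · have := toBlock_mul_eq_add q p q Qᵀ Q
    rw [hQ, toBlock_one_self, h1, Matrix.mul_zero, add_zero] at this
    exact this.symm
  · have := toBlock_mul_eq_add p q p Q Qᵀ
    rw [hQ', toBlock_one_self, h2, Matrix.zero_mul, add_zero] at this
    exact this.symm
  · have h3 := toBlock_mul_eq_add p p q (A.map (Int.cast : ℤ → ℚ) * A.map (Int.cast : ℤ → ℚ)) Q
    have h4 := toBlock_mul_eq_add p q q Q (B.map (Int.cast : ℤ → ℚ) * B.map (Int.cast : ℤ → ℚ))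
    rw [h1, Matrix.mul_zero, add_zero] at h3
    rw [h2, Matrix.zero_mul, add_zero] at h4
    rw [hblock, hblock, ← h3, ← h4]
    congr 1
    rw [Matrix.mul_assoc, h, ← Matrix.mul_assoc, h, Matrix.mul_assoc]

/-- An integral orthogonal matrix with unit row sums is a permutation matrix. -/
theorem exists_eq_permMatrix {ι : Type*} [Fintype ι] [DecidableEq ι] {Q : Matrix ι ι ℤ}
    (hQ : Q * Qᵀ = 1) (h1 : Q *ᵥ 1 = 1) : ∃ σ : Equiv.Perm ι, Q = σ.permMatrix ℤ := by
  have hsq (i) : ∑ j, Q i j * Q i j = 1 := by simpa [mul_apply] using congrFun₂ hQ i i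
  have hsum (i) : ∑ j, Q i j = 1 := by simpa [mulVec, dotProduct] using congrFun h1 i
  have h01 (i j) : Q i j * Q i j = Q i j := by
    have h0 : ∑ j, (Q i j * Q i j - Q i j) = 0 := by
      rw [Finset.sum_sub_distrib, hsq, hsum, sub_self]
    have hnn (j) : 0 ≤ Q i j * Q i j - Q i j := by
      rcases le_or_gt (Q i j) 0 with h | h <;> nlinarith
    exact sub_eq_zero.1
      ((Finset.sum_eq_zero_iff_of_nonneg fun j _ => hnn j).1 h0 j (Finset.mem_univ j))
  have hval (i j) : Q i j = 0 ∨ Q i j = 1 := by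
    rcases eq_or_ne (Q i j) 0 with h | h
    · exact .inl h
    · exact .inr (mul_left_cancel₀ h (by rw [h01, mul_one]))
  have hex (i) : ∃ j, Q i j ≠ 0 := by
    by_contra! h
    simpa [h] using hsum i
  choose f hf using hex
  have hf1 (i) : Q i (f i) = 1 := (hval i _).resolve_left (hf i)
  have hnn (i j) : 0 ≤ Q i j := by rcases hval i j with h | h <;> simp [h]
  have hf0 (i j) (hj : j ≠ f i) : Q i j = 0 := by
    have h2 := hsum i
    rw [← Finset.add_sum_erase _ _ (Finset.mem_univ (f i)), hf1, add_eq_left] at h2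
    exact (Finset.sum_eq_zero_iff_of_nonneg fun j _ => hnn i j).1 h2 j (by simpa using hj)
  have hinj : Function.Injective f := by
    intro i i' hii
    by_contra hne
    have h2 : ∑ j, Q i j * Q i' j = 0 := by
      simpa [mul_apply, one_apply_ne hne] using congrFun₂ hQ i i'
    have h3 := (Finset.sum_eq_zero_iff_of_nonneg
      fun j _ => mul_nonneg (hnn i j) (hnn i' j)).1 h2 (f i) (Finset.mem_univ _)
    rw [hf1, hii, hf1] at h3
    exact one_ne_zero h3
  refine ⟨Equiv.ofBijective f (Finite.injective_iff_bijective.1 hinj), ?_⟩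
  ext i j
  rw [Equiv.Perm.permMatrix, PEquiv.toMatrix_toPEquiv_apply, Equiv.ofBijective_apply,
    Pi.single_apply]
  split_ifs with h
  · rw [h, hf1]
  · exact hf0 i j h

end Intertwiner

section Main

variable {n : ℕ}

theorem exists_int_map_eq_of_intertwiner (hn : n ≠ 1) {p q : Fin n → Prop}
    {A B : Matrix (Fin n) (Fin n) ℤ} (hAs : A.IsSymm) (hBs : B.IsSymm)
    (hA : Irreducible (A.map (Int.cast : ℤ → ℚ)).charpoly)
    (hp : ∀ i j, A i j ≠ 0 → (p i ↔ ¬ p j)) {d : ℤ} (hd : Squarefree d)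
    (hdisc : polyDisc n (A.map (Int.cast : ℤ → ℂ)).charpoly = 2 ^ n * (d : ℂ) ^ 2)
    {Q : Matrix (Fin n) (Fin n) ℚ} (hQ : Qᵀ * Q = 1) (hQ' : Q * Qᵀ = 1)
    (h : A.map (Int.cast : ℤ → ℚ) * Q = Q * B.map (Int.cast : ℤ → ℚ))
    (hpq : ∀ i j, Q i j ≠ 0 → (p i ↔ q j)) :
    ∃ R : Matrix (Fin n) (Fin n) ℤ, Q = R.map (Int.cast : ℤ → ℚ) := by
  obtain ⟨R₁, hR₁⟩ := exists_int_toBlock_eq hn hAs hBs hA hp hd hdisc hQ hQ' h hpq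
  obtain ⟨R₂, hR₂⟩ := exists_int_toBlock_eq hn hAs hBs hA
    (fun i j hij => not_congr (hp i j hij)) hd hdisc hQ hQ' h
    (fun i j hij => not_congr (hpq i j hij))
  have hint (i j) : ∃ z : ℤ, Q i j = z := by
    by_cases h0 : Q i j = 0
    · exact ⟨0, by simpa using h0⟩
    by_cases hi : p i
    · exact ⟨_, congrFun₂ hR₁ ⟨i, hi⟩ ⟨j, (hpq i j h0).1 hi⟩⟩
    · exact ⟨_, congrFun₂ hR₂ ⟨i, hi⟩ ⟨j, mt (hpq i j h0).2 hi⟩⟩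
  choose R hR using hint
  exact ⟨of R, ext hR⟩

theorem SimpleGraph.IsTree.exists_bipartition {V : Type*} {T : SimpleGraph V} (hT : T.IsTree) :
    ∃ p : V → Prop, ∀ u v, T.Adj u v → (p u ↔ ¬ p v) := by
  obtain ⟨c⟩ := hT.colorable_two
  refine ⟨fun v => c v = 0, fun u v huv => ?_⟩
  have := c.valid huv
  omega

theorem exists_permMatrix_of_charpoly_eq (hn : n ≠ 1) {p q : Fin n → Prop}
    {A B : Matrix (Fin n) (Fin n) ℤ} (hAs : A.IsSymm) (hBs : B.IsSymm)
    (hA : Irreducible (A.map (Int.cast : ℤ → ℚ)).charpoly)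
    (hp : ∀ i j, A i j ≠ 0 → (p i ↔ ¬ p j)) (hq : ∀ i j, B i j ≠ 0 → (q i ↔ ¬ q j))
    {d : ℤ} (hd : Squarefree d)
    (hdisc : polyDisc n (A.map (Int.cast : ℤ → ℂ)).charpoly = 2 ^ n * (d : ℂ) ^ 2)
    (hc : A.charpoly = B.charpoly)
    (hc' : ((of fun _ _ => (1 : ℤ)) - 1 - A).charpoly
      = ((of fun _ _ => (1 : ℤ)) - 1 - B).charpoly) :
    ∃ σ : Equiv.Perm (Fin n), A * σ.permMatrix ℤ = σ.permMatrix ℤ * B := by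
  have hinj : Function.Injective (Int.cast : ℤ → ℚ) := Int.cast_injective
  have hcQ : (A.map (Int.cast : ℤ → ℚ)).charpoly = (B.map (Int.cast : ℤ → ℚ)).charpoly := by
    rw [charpoly_map_intCast, charpoly_map_intCast, hc]
  have hmapJ (C : Matrix (Fin n) (Fin n) ℤ) :
      (of fun _ _ => (1 : ℚ)) - 1 - C.map (Int.cast : ℤ → ℚ)
        = ((of fun _ _ => (1 : ℤ)) - 1 - C).map (Int.cast : ℤ → ℚ) := by
    ext i j
    by_cases hij : i = j <;> simp [hij]
  have hAs' : (A.map (Int.cast : ℤ → ℚ)).IsSymm := hAs.map _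
  have hBs' : (B.map (Int.cast : ℤ → ℚ)).IsSymm := hBs.map _
  obtain ⟨Q, hQ, hQ', hQ1, h⟩ := exists_orthogonal_of_walkCount_eq hA (hcQ ▸ hA) hAs' hBs'
    (walkCount_eq_of_charpoly_eq hcQ
      (by rw [hmapJ, hmapJ, charpoly_map_intCast, charpoly_map_intCast, hc']))
  have hR : ∃ R : Matrix (Fin n) (Fin n) ℤ, Q = R.map (Int.cast : ℤ → ℚ) := by
    rcases block_of_intertwiner hA hAs' hBs' (fun i j hij => hp i j (by simpa using hij))
      (fun i j hij => hq i j (by simpa using hij)) hQ hQ' h with hpq | hpq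
    · exact exists_int_map_eq_of_intertwiner hn hAs hBs hA hp hd hdisc hQ hQ' h hpq
    · exact exists_int_map_eq_of_intertwiner hn hAs hBs hA hp hd hdisc hQ hQ' h hpq
  obtain ⟨R, rfl⟩ := hR
  have hmul (C D : Matrix (Fin n) (Fin n) ℤ) :
      C.map (Int.cast : ℤ → ℚ) * D.map (Int.cast : ℤ → ℚ) = (C * D).map (Int.cast : ℤ → ℚ) :=
    (Matrix.map_mul (f := Int.castRingHom ℚ)).symm
  rw [hmul, hmul] at h
  rw [← transpose_map, hmul] at hQ'
  obtain ⟨σ, rfl⟩ := exists_eq_permMatrix (Q := R)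
    (map_injective hinj (hQ'.trans (by simp)))
    (by
      ext i
      apply hinj
      simpa [mulVec, dotProduct] using congrFun hQ1 i)
  exact ⟨σ, map_injective hinj h⟩

end Main

theorem stmt2 {n : ℕ} (T T' : SimpleGraph (Fin n))
    [DecidableRel T.Adj] [DecidableRel T'.Adj]
    (hT : T.IsTree) (hT' : T'.IsTree)
    (hcospec : (T.adjMatrix ℚ).charpoly = (T'.adjMatrix ℚ).charpoly)
    (hniso : ¬ ∃ σ : Equiv.Perm (Fin n),
      (σ.permMatrix ℤ)ᵀ * T.adjMatrix ℤ * σ.permMatrix ℤ = T'.adjMatrix ℤ)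
    (hirr : Irreducible (T.adjMatrix ℚ).charpoly)
    (d : ℤ) (hd0 : 0 < d) (hdodd : Odd d) (hdsf : Squarefree d)
    (hdisc : polyDisc n (T.adjMatrix ℂ).charpoly = 2 ^ n * (d : ℂ) ^ 2)
    (A : Matrix (Fin n) (Fin n) ℤ) (hA : IsSignedAdjMatrix A)
    (hAT : ∀ i j, A i j ≠ 0 ↔ T.Adj i j)
    (B : Matrix (Fin n) (Fin n) ℤ) (hB : IsSignedAdjMatrix B)
    (hBT' : ∀ i j, B i j ≠ 0 ↔ T'.Adj i j) :
    A.charpoly ≠ B.charpoly ∨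
      ((Matrix.of fun _ _ => (1 : ℤ)) - 1 - A).charpoly
        ≠ ((Matrix.of fun _ _ => (1 : ℤ)) - 1 - B).charpoly := by
  by_contra! hcon
  obtain ⟨hc, hc'⟩ := hcon
  have hn : n ≠ 1 := by
    rintro rfl
    refine hniso ⟨1, ?_⟩
    ext i j
    rw [Subsingleton.elim i j]
    simp
  have hmap (K : Type) [CommRing K] :
      (A.map (Int.cast : ℤ → K)).charpoly = (T.adjMatrix K).charpoly := by
    rw [charpoly_map_intCast, hT.charpoly_eq_of_isSignedAdjMatrix hA hAT, ← charpoly_map_intCast]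
    congr 1
    ext i j
    simp [SimpleGraph.adjMatrix_apply]
  obtain ⟨p, hp⟩ := hT.exists_bipartition
  obtain ⟨q, hq⟩ := hT'.exists_bipartition
  obtain ⟨σ, hσ⟩ := exists_permMatrix_of_charpoly_eq hn hA.1 hB.1 (hmap ℚ ▸ hirr)
    (fun i j hij => hp i j ((hAT i j).1 hij)) (fun i j hij => hq i j ((hBT' i j).1 hij))
    hdsf ((congrArg _ (hmap ℂ)).trans hdisc) hc hc'
  have hσ' (i j) : A i (σ.symm j) = B (σ i) j := by
    simpa [Equiv.Perm.permMatrix, PEquiv.mul_toMatrix_toPEquiv, PEquiv.toMatrix_toPEquiv_mul]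
      using congrFun₂ hσ i j
  have hadj (i j) : T.Adj (σ.symm i) (σ.symm j) ↔ T'.Adj i j := by
    rw [← hAT, ← hBT', hσ', Equiv.apply_symm_apply]
  refine hniso ⟨σ, ?_⟩
  ext i j
  rw [transpose_permMatrix, Equiv.Perm.permMatrix, Equiv.Perm.permMatrix,
    PEquiv.mul_toMatrix_toPEquiv, PEquiv.toMatrix_toPEquiv_mul]
  simp [SimpleGraph.adjMatrix_apply, hadj]
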